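/- arXiv:1312.5434 — 4 statements merged into one kernel-verified Lean document; each statement's English description precedes it below -/
import Mathlib

section
/- For each k in a finite nonempty index set, let μ̄_k > 0, c_{μ,k,k} ≥ 0, 0 < λ_{k,min} ≤ λ_{k,max}, and let α ≥ 0. Define γ_k² = 1 − 2μ̄_k λ_{k,min} + (μ̄_k² + c_{μ,k,k}) λ_{k,max}² and β = max_k ( γ_k² + α(μ̄_k² + c_{μ,k,k}) ). If the stability condition (μ̄_k² + c_{μ,k,k})/μ̄_k < λ_{k,min}/(α + λ_{k,max}²) holds for every k, then |β| < 1; more precisely, 1 − β ≥ (min_k μ̄_k)·(min_k λ_{k,min}) > 0 and β > −1. -/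
/-- The stability condition bounds the mean-square contraction factor by `1 - m * l`. -/
theorem contraction_factor_lt_of_stability {m c l L a : ℝ} (hm : 0 < m) (hl : 0 < l)
    (hlL : l ≤ L) (ha : 0 ≤ a) (h : (m ^ 2 + c) / m < l / (a + L ^ 2)) :
    1 - 2 * m * l + (m ^ 2 + c) * L ^ 2 + a * (m ^ 2 + c) < 1 - m * l := by
  have hL : 0 < L := hl.trans_le hlL
  rw [div_lt_div_iff₀ hm (by positivity)] at h
  linarith

/-- The mean-square contraction factor is nonnegative. -/
theorem contraction_factor_nonneg {m c l L a : ℝ} (hc : 0 ≤ c) (hl : 0 < l)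
    (hlL : l ≤ L) (ha : 0 ≤ a) :
    0 ≤ 1 - 2 * m * l + (m ^ 2 + c) * L ^ 2 + a * (m ^ 2 + c) := by
  have hsq : m ^ 2 * l ^ 2 ≤ m ^ 2 * L ^ 2 := by gcongr
  have h₁ : 0 ≤ c * L ^ 2 := by positivity
  have h₂ : 0 ≤ a * (m ^ 2 + c) := by positivity
  linarith [sq_nonneg (1 - m * l)]

/-- Stability-condition portion of Theorem 1: under the step-size condition
`(μ̄_k² + c_k)/μ̄_k < λ_{k,min}/(α + λ_{k,max}²)` for all `k`, the convergence factor
`β = max_k (γ_k² + α(μ̄_k² + c_k))` satisfies `|β| < 1`; more precisely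
`1 − β ≥ (min_k μ̄_k)·(min_k λ_{k,min})` and `β > −1`. -/
theorem beta_lt_one_of_stability_condition
    {K : Type*} [Fintype K] [Nonempty K]
    (μb c lmin lmax : K → ℝ) (α : ℝ)
    (hμ : ∀ k, 0 < μb k) (hc : ∀ k, 0 ≤ c k)
    (hlmin : ∀ k, 0 < lmin k) (hl : ∀ k, lmin k ≤ lmax k) (hα : 0 ≤ α)
    (γsq : K → ℝ)
    (hγ : γsq = fun k => 1 - 2 * μb k * lmin k + (μb k ^ 2 + c k) * lmax k ^ 2)
    (β : ℝ)
    (hβ : β = Finset.univ.sup' Finset.univ_nonempty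
      (fun k => γsq k + α * (μb k ^ 2 + c k)))
    (hstab : ∀ k, (μb k ^ 2 + c k) / μb k < lmin k / (α + lmax k ^ 2)) :
    |β| < 1 ∧
      (Finset.univ.inf' Finset.univ_nonempty μb) *
        (Finset.univ.inf' Finset.univ_nonempty lmin) ≤ 1 - β ∧
      -1 < β := by
  subst hγ
  obtain ⟨k, -, hk⟩ := Finset.exists_mem_eq_sup' Finset.univ_nonempty
    (fun k => (1 - 2 * μb k * lmin k + (μb k ^ 2 + c k) * lmax k ^ 2) + α * (μb k ^ 2 + c k))
  rw [hk] at hβ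
  have hlt : β < 1 - μb k * lmin k :=
    hβ ▸ contraction_factor_lt_of_stability (hμ k) (hlmin k) (hl k) hα (hstab k)
  have hnonneg : 0 ≤ β := hβ ▸ contraction_factor_nonneg (hc k) (hlmin k) (hl k) hα
  have hpos : 0 < μb k * lmin k := mul_pos (hμ k) (hlmin k)
  have hmin : Finset.univ.inf' Finset.univ_nonempty μb *
      Finset.univ.inf' Finset.univ_nonempty lmin ≤ μb k * lmin k :=
    mul_le_mul (Finset.inf'_le _ (Finset.mem_univ k)) (Finset.inf'_le _ (Finset.mem_univ k))
      (Finset.le_inf' _ _ fun j _ => (hlmin j).le) (hμ k).le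
  exact ⟨abs_lt.2 ⟨by linarith, by linarith⟩, by linarith, by linarith⟩
end

section
/- For each k in a finite nonempty index set, let μ̄_k > 0, c_{μ,k,k} ≥ 0, 0 < λ_{k,min} ≤ λ_{k,max}, α ≥ 0, and σ_v² ≥ 0. Define γ_k² = 1 − 2μ̄_k λ_{k,min} + (μ̄_k² + c_{μ,k,k}) λ_{k,max}², β = max_k ( γ_k² + α(μ̄_k² + c_{μ,k,k}) ), θ = max_k (μ̄_k² + c_{μ,k,k}), ν₀ = max_k (μ̄_k² + c_{μ,k,k})/μ̄_k, and let κ > 0 satisfy (max_k μ̄_k)/(min_k μ̄_k) ≤ κ. If (μ̄_k² + c_{μ,k,k})/μ̄_k < λ_{k,min}/(α + λ_{k,max}²) for every k, then θσ_v²/(1 − β) ≤ ( κ σ_v² / min_k λ_{k,min} ) · ν₀. -/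
/-- Steady-state MSD bound of Theorem 1: under the mean-square stability condition,
the asymptotic limit `θσ_v²/(1 − β)` of the error recursion is bounded by
`(κσ_v²/min_k λ_{k,min}) · ν₀`, where `ν₀ = max_k (μ̄_k² + c_k)/μ̄_k`. -/
theorem steady_state_msd_bound
    {K : Type*} [Fintype K] [Nonempty K]
    (μb c lmin lmax : K → ℝ) (α σv2 : ℝ)
    (hμ : ∀ k, 0 < μb k) (hc : ∀ k, 0 ≤ c k)
    (hlmin : ∀ k, 0 < lmin k) (hl : ∀ k, lmin k ≤ lmax k)
    (hα : 0 ≤ α) (hσ : 0 ≤ σv2)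
    (γsq : K → ℝ)
    (hγ : γsq = fun k => 1 - 2 * μb k * lmin k + (μb k ^ 2 + c k) * lmax k ^ 2)
    (β θ ν₀ κ : ℝ)
    (hβ : β = Finset.univ.sup' Finset.univ_nonempty
      (fun k => γsq k + α * (μb k ^ 2 + c k)))
    (hθ : θ = Finset.univ.sup' Finset.univ_nonempty (fun k => μb k ^ 2 + c k))
    (hν : ν₀ = Finset.univ.sup' Finset.univ_nonempty
      (fun k => (μb k ^ 2 + c k) / μb k))
    (hκ0 : 0 < κ)
    (hκ : (Finset.univ.sup' Finset.univ_nonempty μb) /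
      (Finset.univ.inf' Finset.univ_nonempty μb) ≤ κ)
    (hstab : ∀ k, (μb k ^ 2 + c k) / μb k < lmin k / (α + lmax k ^ 2)) :
    θ * σv2 / (1 - β) ≤
      κ * σv2 / (Finset.univ.inf' Finset.univ_nonempty lmin) * ν₀ := by
  subst hγ
  set M := Finset.univ.sup' Finset.univ_nonempty μb
  set m := Finset.univ.inf' Finset.univ_nonempty μb
  set L := Finset.univ.inf' Finset.univ_nonempty lmin
  have hm : 0 < m := (Finset.lt_inf'_iff _).2 fun k _ => hμ k
  have hL : 0 < L := (Finset.lt_inf'_iff _).2 fun k _ => hlmin k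
  have hm_le (k : K) : m ≤ μb k := Finset.inf'_le _ (Finset.mem_univ k)
  have hL_le (k : K) : L ≤ lmin k := Finset.inf'_le _ (Finset.mem_univ k)
  have hle_M (k : K) : μb k ≤ M := Finset.le_sup' _ (Finset.mem_univ k)
  have hle_ν (k : K) : (μb k ^ 2 + c k) / μb k ≤ ν₀ :=
    hν ▸ Finset.le_sup' (fun k => (μb k ^ 2 + c k) / μb k) (Finset.mem_univ k)
  have hν_nonneg : 0 ≤ ν₀ := by
    obtain ⟨k⟩ := ‹Nonempty K›
    have := hμ k
    have := hc k
    exact le_trans (by positivity) (hle_ν k)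
  have hM : M ≤ κ * m := (div_le_iff₀ hm).1 hκ
  have hθ_le : θ ≤ κ * m * ν₀ := by
    rw [hθ]
    refine Finset.sup'_le _ _ fun k _ => ?_
    calc μb k ^ 2 + c k ≤ ν₀ * μb k := (div_le_iff₀ (hμ k)).1 (hle_ν k)
      _ ≤ ν₀ * (κ * m) := mul_le_mul_of_nonneg_left ((hle_M k).trans hM) hν_nonneg
      _ = κ * m * ν₀ := mul_comm _ _
  have hβ_le : β ≤ 1 - m * L := by
    rw [hβ]
    refine Finset.sup'_le _ _ fun k _ => ?_
    have hpos : 0 < α + lmax k ^ 2 := by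
      have := (hlmin k).trans_le (hl k)
      positivity
    have hstab_k := hstab k
    rw [div_lt_div_iff₀ (hμ k) hpos] at hstab_k
    have hmL : m * L ≤ μb k * lmin k := mul_le_mul (hm_le k) (hL_le k) hL.le (hμ k).le
    linarith
  have hmL : 0 < m * L := mul_pos hm hL
  calc θ * σv2 / (1 - β) ≤ κ * m * ν₀ * σv2 / (m * L) := by
        gcongr
        linarith
    _ = κ * σv2 / L * ν₀ := by field_simp
end

section
/- Let φ > 0, ξ > 0, μ > 0, and set μ̄ = μ/(1+φ) and c = φμ²/( (1+φ)² (ξ(1+φ)+1) ) (the mean and variance of a Beta-distributed step-size with shape parameters ξ and ζ = φξ scaled to the range [0, μ]). Then (μ̄² + c)/μ̄ = μ(1+ξ)/( (1+ξ) + ξφ ). Consequently, for any 0 < λ_min ≤ λ_max and α ≥ 0, the stability condition (μ̄² + c)/μ̄ < λ_min/(α + λ_max²) holds if and only if μ < (1 + φξ/(1+ξ)) · λ_min/(α + λ_max²); moreover this upper bound on μ is strictly larger than λ_min/(α + λ_max²). -/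
/-- Beta model: with mean `μ̄ = μ/(1+φ)` and variance
`c = φμ²/((1+φ)²(ξ(1+φ)+1))` of the scaled Beta step-size, one has
`(μ̄² + c)/μ̄ = μ(1+ξ)/((1+ξ)+ξφ)`; hence the stability condition
`(μ̄² + c)/μ̄ < λ_min/(α + λ_max²)` holds iff
`μ < (1 + φξ/(1+ξ))·λ_min/(α + λ_max²)`, and this bound exceeds
`λ_min/(α + λ_max²)`. -/
theorem beta_model_stability
    {φ ξ μ : ℝ} (hφ : 0 < φ) (hξ : 0 < ξ) (hμ : 0 < μ)
    (μbar c : ℝ) (hμbar : μbar = μ / (1 + φ))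
    (hc : c = φ * μ ^ 2 / ((1 + φ) ^ 2 * (ξ * (1 + φ) + 1))) :
    (μbar ^ 2 + c) / μbar = μ * (1 + ξ) / ((1 + ξ) + ξ * φ) ∧
      ∀ lmin lmax α : ℝ, 0 < lmin → lmin ≤ lmax → 0 ≤ α →
        (((μbar ^ 2 + c) / μbar < lmin / (α + lmax ^ 2) ↔
            μ < (1 + φ * ξ / (1 + ξ)) * (lmin / (α + lmax ^ 2))) ∧
          lmin / (α + lmax ^ 2) <
            (1 + φ * ξ / (1 + ξ)) * (lmin / (α + lmax ^ 2))) := by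
  have key : (μbar ^ 2 + c) / μbar = μ * (1 + ξ) / ((1 + ξ) + ξ * φ) := by
    have hφ' : 1 + φ ≠ 0 := by positivity
    have hvar : ξ * (1 + φ) + 1 ≠ 0 := by positivity
    have hden : (1 + ξ) + ξ * φ ≠ 0 := by positivity
    subst hμbar hc
    field_simp
    ring
  refine ⟨key, fun lmin lmax α hmin hle hα => ?_⟩
  have hmax : 0 < lmax := hmin.trans_le hle
  have hbound : 0 < lmin / (α + lmax ^ 2) := by positivity
  have hfactor : 1 + φ * ξ / (1 + ξ) = ((1 + ξ) + ξ * φ) / (1 + ξ) := by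
    field_simp
  refine ⟨?_, lt_mul_of_one_lt_left hbound (lt_add_of_pos_right 1 (by positivity))⟩
  rw [key, hfactor, div_mul_eq_mul_div, div_lt_iff₀ (by positivity),
    lt_div_iff₀ (by positivity), mul_comm (lmin / _)]
end

section
/- Let x and y be vectors in a complex inner product space. Then ‖x + y‖⁴ ≤ ‖x‖⁴ + 8‖x‖²‖y‖² + 3‖y‖⁴ + 4‖x‖²·Re⟨x, y⟩. -/
open scoped InnerProductSpace

/-- Lemma 5 (fourth-order inequality): for vectors `x, y` in a complex inner product
space, `‖x + y‖⁴ ≤ ‖x‖⁴ + 8‖x‖²‖y‖² + 3‖y‖⁴ + 4‖x‖²·Re⟪x, y⟫`. -/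
theorem norm_add_pow_four_le
    {E : Type*} [NormedAddCommGroup E] [InnerProductSpace ℂ E] (x y : E) :
    ‖x + y‖ ^ 4 ≤ ‖x‖ ^ 4 + 8 * ‖x‖ ^ 2 * ‖y‖ ^ 2 + 3 * ‖y‖ ^ 4 +
      4 * ‖x‖ ^ 2 * (⟪x, y⟫_ℂ).re := by
  have hsq := norm_add_sq (𝕜 := ℂ) x y
  have habs : |(⟪x, y⟫_ℂ).re| ≤ ‖x‖ * ‖y‖ :=
    (Complex.abs_re_le_norm _).trans (norm_inner_le_norm x y)
  have hr_sq : (⟪x, y⟫_ℂ).re ^ 2 ≤ (‖x‖ * ‖y‖) ^ 2 := sq_le_sq.2 (habs.trans (le_abs_self _))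
  have hr_mul : ‖y‖ ^ 2 * (⟪x, y⟫_ℂ).re ≤ ‖y‖ ^ 2 * (‖x‖ * ‖y‖) :=
    mul_le_mul_of_nonneg_left ((le_abs_self _).trans habs) (sq_nonneg _)
  have hpow : ‖x + y‖ ^ 4 = (‖x‖ ^ 2 + 2 * (⟪x, y⟫_ℂ).re + ‖y‖ ^ 2) ^ 2 := by
    rw [show ‖x + y‖ ^ 4 = (‖x + y‖ ^ 2) ^ 2 by ring, hsq]
    rfl
  rw [hpow]
  linarith [mul_nonneg (sq_nonneg ‖y‖) (sq_nonneg (‖x‖ - ‖y‖))]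
end
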